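/- arXiv:1504.03367 — 3 statements merged into one kernel-verified Lean document; each statement's English description precedes it below -/
import Mathlib

section
/- Under these hypotheses, for every real ε > 0, if P(m·ε) holds then P(ε) holds. (One-step descent lemma underlying the Proposition: approximation of algebraic points by a finitely generated subgroup of an abelian variety, abstracted to its metric content.) -/
/-- `ApproxFinite h F δ` is the property `P(δ)`: for every point `α ∈ X` and every
real `C > 0`, the set `{x ∈ F : dist α x ≤ C · exp (−δ · h x)}` is finite. -/
def ApproxFinite {X : Type*} [MetricSpace X] (h : X → ℝ) (F : Set X) (δ : ℝ) : Prop :=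
  ∀ α : X, ∀ C : ℝ, 0 < C → {x ∈ F | dist α x ≤ C * Real.exp (-δ * h x)}.Finite

open Filter Topology in
/-- The pullback form of the approximation property: if `φ` is continuous and locally expanding,
and points of bounded height are finite in number, then `P(δ)` implies that only finitely many
`y ∈ F` have `φ y` exponentially close to a given point. -/
theorem ApproxFinite.finite_preimage {X : Type*} [MetricSpace X] [CompactSpace X]
    {h : X → ℝ} {F : Set X} {δ c r : ℝ} {φ : X → X} (hP : ApproxFinite h F δ)
    (hφ : Continuous φ) (hδ : 0 < δ) (hc : 0 < c) (hr : 0 < r)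
    (hexpand : ∀ x y : X, dist x y ≤ r → c * dist x y ≤ dist (φ x) (φ y))
    (hNorthcott : ∀ B : ℝ, {x ∈ F | h x ≤ B}.Finite) (α : X) {C : ℝ} (hC : 0 < C) :
    {y ∈ F | dist α (φ y) ≤ C * Real.exp (-δ * h y)}.Finite := by
  by_contra hT
  set T := {y ∈ F | dist α (φ y) ≤ C * Real.exp (-δ * h y)}
  obtain ⟨β, hβ⟩ := Set.Infinite.exists_accPt_principal hT
  have hne : (𝓝[≠] β ⊓ 𝓟 T).NeBot := hβ
  have hTG : T ∈ 𝓝[≠] β ⊓ 𝓟 T := mem_inf_of_right (mem_principal_self T)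
  have avoid : ∀ s : Set X, s.Finite → sᶜ ∈ 𝓝[≠] β ⊓ 𝓟 T := fun s hs =>
    mem_inf_of_left (nhdsNE_le_cofinite β hs.compl_mem_cofinite)
  have hG : 𝓝[≠] β ⊓ 𝓟 T ≤ 𝓝 β := inf_le_left.trans nhdsWithin_le_nhds
  have hh : Tendsto h (𝓝[≠] β ⊓ 𝓟 T) atTop := by
    refine tendsto_atTop.2 fun B => ?_
    filter_upwards [avoid _ (hNorthcott B), hTG] with y hy hyT
    by_contra! hlt
    exact hy ⟨hyT.1, hlt.le⟩
  have hbound : Tendsto (fun y => C * Real.exp (-δ * h y)) (𝓝[≠] β ⊓ 𝓟 T) (𝓝 0) := by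
    have := (Real.tendsto_exp_atBot.comp
      (hh.const_mul_atTop_of_neg (neg_lt_zero.2 hδ))).const_mul C
    simpa using this
  have hlim : Tendsto (fun y => dist α (φ y)) (𝓝[≠] β ⊓ 𝓟 T) (𝓝 (dist α (φ β))) :=
    ((continuous_const.dist hφ).tendsto β).mono_left hG
  have hαβ : α = φ β :=
    dist_le_zero.1 (le_of_tendsto_of_tendsto hlim hbound (by
      filter_upwards [hTG] with y hy using hy.2))
  have hfalse : ∀ᶠ _ in 𝓝[≠] β ⊓ 𝓟 T, False := by
    filter_upwards [avoid _ (hP β (C / c) (div_pos hC hc)), hTG,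
      hG (Metric.closedBall_mem_nhds β hr)] with y hy hyT hyr
    refine hy ⟨hyT.1, ?_⟩
    have hexp := hexpand β y (by rw [dist_comm]; exact hyr)
    rw [← hαβ] at hexp
    rw [div_mul_eq_mul_div, le_div_iff₀ hc, mul_comm]
    exact hexp.trans hyT.2
  exact hfalse.exists.elim fun _ hx => hx

/-- One-step descent lemma: under the covering, height-expansion, local metric
expansion, Northcott and nonnegativity hypotheses, for every `ε > 0`,
`P(m·ε)` implies `P(ε)`. -/
theorem one_step_descent_points {X : Type*} [MetricSpace X] [CompactSpace X]
    (h : X → ℝ) (F : Set X) (k : ℕ) (φ : Fin k → X → X)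
    (hφcont : ∀ i, Continuous (φ i))
    (m C₁ c r : ℝ) (hm : 1 < m) (hC₁ : 0 ≤ C₁) (hc : 0 < c) (hr : 0 < r)
    (hcover : ∀ x ∈ F, ∃ i, ∃ y ∈ F, φ i y = x)
    (hheight : ∀ i, ∀ y ∈ F, m * h y - C₁ ≤ h (φ i y))
    (hexpand : ∀ i, ∀ x y : X, dist x y ≤ r → c * dist x y ≤ dist (φ i x) (φ i y))
    (hNorthcott : ∀ B : ℝ, {x ∈ F | h x ≤ B}.Finite)
    (hnonneg : ∀ x ∈ F, 0 ≤ h x)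
    (ε : ℝ) (hε : 0 < ε)
    (hP : ApproxFinite h F (m * ε)) :
    ApproxFinite h F ε := by
  intro α C hC
  have hfin := Set.finite_iUnion fun i =>
    (hP.finite_preimage (hφcont i) (mul_pos (by linarith) hε) hc hr (hexpand i) hNorthcott α
      (mul_pos hC (Real.exp_pos (ε * C₁)))).image (φ i)
  refine hfin.subset ?_
  rintro x ⟨hxF, hx⟩
  obtain ⟨i, y, hyF, rfl⟩ := hcover x hxF
  refine Set.mem_iUnion.2 ⟨i, y, ⟨hyF, hx.trans ?_⟩, rfl⟩
  rw [mul_assoc, ← Real.exp_add]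
  gcongr
  nlinarith [mul_le_mul_of_nonneg_left (hheight i y hyF) hε.le]
end

section
/- Under these hypotheses, if there exists some real δ₀ > 0 such that P(δ₀) holds, then P(δ) holds for every real δ > 0. (Abstract form of the improvement of Roth's theorem on diophantine approximation of points of an abelian variety by a finitely generated subgroup.) -/
/-- Assuming `P(δ)` and the Northcott property, the points of `F` whose images under a locally
expanding continuous map `f` approximate `α` to order `δ` form a finite set. -/
theorem ApproxFinite.finite_image_approx {X : Type*} [MetricSpace X] [CompactSpace X]
    {h : X → ℝ} {F : Set X} {f : X → X} {c r δ : ℝ} (hP : ApproxFinite h F δ)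
    (hf : Continuous f) (hc : 0 < c) (hr : 0 < r)
    (hexpand : ∀ x y : X, dist x y ≤ r → c * dist x y ≤ dist (f x) (f y))
    (hNorthcott : ∀ B : ℝ, {x ∈ F | h x ≤ B}.Finite) (hδ : 0 < δ)
    (α : X) {C : ℝ} (hC : 0 < C) :
    {y ∈ F | dist α (f y) ≤ C * Real.exp (-δ * h y)}.Finite := by
  by_contra hT
  obtain ⟨β, hβ⟩ := Set.Infinite.exists_accPt_principal hT
  have hinf : ∀ U ∈ nhds β,
      (U ∩ {y ∈ F | dist α (f y) ≤ C * Real.exp (-δ * h y)}).Infinite :=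
    fun U hU => .of_accPt (hβ.nhds_inter hU)
  have hfβ : f β = α := by
    by_contra hne
    have hε : 0 < dist α (f β) / 2 := half_pos (dist_pos.mpr (Ne.symm hne))
    refine hinf _ (hf.continuousAt.preimage_mem_nhds (Metric.ball_mem_nhds (f β) hε))
      ((hNorthcott (Real.log (C / (dist α (f β) / 2)) / δ)).subset ?_)
    rintro y ⟨hyU, hyF, hy⟩
    refine ⟨hyF, ?_⟩
    have hyU' : dist (f y) (f β) < dist α (f β) / 2 := hyU
    have hle : dist α (f β) / 2 ≤ C * Real.exp (-δ * h y) := by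
      linarith [dist_triangle α (f y) (f β)]
    rw [le_div_iff₀ hδ, Real.le_log_iff_exp_le (by positivity), le_div_iff₀ hε]
    calc Real.exp (h y * δ) * (dist α (f β) / 2)
        ≤ Real.exp (h y * δ) * (C * Real.exp (-δ * h y)) := by gcongr
      _ = C * Real.exp (h y * δ + -δ * h y) := by rw [Real.exp_add]; ring
      _ = C := by rw [show h y * δ + -δ * h y = 0 by ring, Real.exp_zero, mul_one]
  refine hinf _ (Metric.closedBall_mem_nhds β hr) ((hP β (C / c) (by positivity)).subset ?_)
  rintro y ⟨hyU, hyF, hy⟩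
  refine ⟨hyF, ?_⟩
  have hexp := hexpand β y (by rw [dist_comm]; exact hyU)
  rw [hfβ] at hexp
  rw [div_mul_eq_mul_div, le_div_iff₀ hc]
  linarith

/-- `P(δ)` is monotone in `δ` when the height is nonnegative on `F`. -/
theorem ApproxFinite.mono {X : Type*} [MetricSpace X] {h : X → ℝ} {F : Set X} {δ δ' : ℝ}
    (hP : ApproxFinite h F δ) (hnonneg : ∀ x ∈ F, 0 ≤ h x) (hle : δ ≤ δ') :
    ApproxFinite h F δ' := by
  intro α C hC
  refine (hP α C hC).subset ?_
  rintro x ⟨hxF, hx⟩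
  refine ⟨hxF, hx.trans ?_⟩
  have := hnonneg x hxF
  gcongr

/-- Descent along the covering maps: `P(δ)` implies `P(δ / m)`. -/
theorem ApproxFinite.div {X ι : Type*} [MetricSpace X] [CompactSpace X] [Finite ι]
    {h : X → ℝ} {F : Set X} {φ : ι → X → X} {m C₁ c r δ : ℝ} (hP : ApproxFinite h F δ)
    (hφcont : ∀ i, Continuous (φ i)) (hm : 0 < m) (hc : 0 < c) (hr : 0 < r)
    (hcover : ∀ x ∈ F, ∃ i, ∃ y ∈ F, φ i y = x)
    (hheight : ∀ i, ∀ y ∈ F, m * h y - C₁ ≤ h (φ i y))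
    (hexpand : ∀ i, ∀ x y : X, dist x y ≤ r → c * dist x y ≤ dist (φ i x) (φ i y))
    (hNorthcott : ∀ B : ℝ, {x ∈ F | h x ≤ B}.Finite) (hδ : 0 < δ) :
    ApproxFinite h F (δ / m) := by
  intro α C hC
  refine (Set.finite_iUnion fun i => (hP.finite_image_approx (hφcont i) hc hr (hexpand i)
    hNorthcott hδ α (C := C * Real.exp (δ / m * C₁)) (by positivity)).image (φ i)).subset ?_
  rintro x ⟨hxF, hx⟩
  obtain ⟨i, y, hyF, rfl⟩ := hcover x hxF
  refine Set.mem_iUnion.mpr ⟨i, y, ⟨hyF, hx.trans ?_⟩, rfl⟩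
  rw [mul_assoc, ← Real.exp_add]
  gcongr
  calc -(δ / m) * h (φ i y) = -(δ / m * h (φ i y)) := by ring
    _ ≤ -(δ / m * (m * h y - C₁)) := by
      gcongr
      exact hheight i y hyF
    _ = δ / m * C₁ + -δ * h y := by field_simp; ring

/-- Abstract improvement of Roth's theorem: under the covering, height-expansion,
local metric expansion, Northcott and nonnegativity hypotheses, if `P(δ₀)` holds
for some `δ₀ > 0`, then `P(δ)` holds for every `δ > 0`. -/
theorem roth_improvement {X : Type*} [MetricSpace X] [CompactSpace X]
    (h : X → ℝ) (F : Set X) (k : ℕ) (φ : Fin k → X → X)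
    (hφcont : ∀ i, Continuous (φ i))
    (m C₁ c r : ℝ) (hm : 1 < m) (hC₁ : 0 ≤ C₁) (hc : 0 < c) (hr : 0 < r)
    (hcover : ∀ x ∈ F, ∃ i, ∃ y ∈ F, φ i y = x)
    (hheight : ∀ i, ∀ y ∈ F, m * h y - C₁ ≤ h (φ i y))
    (hexpand : ∀ i, ∀ x y : X, dist x y ≤ r → c * dist x y ≤ dist (φ i x) (φ i y))
    (hNorthcott : ∀ B : ℝ, {x ∈ F | h x ≤ B}.Finite)
    (hnonneg : ∀ x ∈ F, 0 ≤ h x)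
    (hδ₀ : ∃ δ₀ : ℝ, 0 < δ₀ ∧ ApproxFinite h F δ₀) :
    ∀ δ : ℝ, 0 < δ → ApproxFinite h F δ := by
  obtain ⟨δ₀, hδ₀pos, hP⟩ := hδ₀
  have hm0 : 0 < m := one_pos.trans hm
  have hpow : ∀ n : ℕ, ApproxFinite h F (δ₀ / m ^ n) := by
    intro n
    induction n with
    | zero => simpa using hP
    | succ n ih =>
      rw [pow_succ, ← div_div]
      exact ih.div hφcont hm0 hc hr hcover hheight hexpand hNorthcott (by positivity)
  intro δ hδ
  obtain ⟨n, hn⟩ := pow_unbounded_of_one_lt (δ₀ / δ) hm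
  refine (hpow n).mono hnonneg ?_
  rw [div_lt_iff₀ hδ] at hn
  rw [div_le_iff₀ (by positivity)]
  linarith
end

section
/- Under these hypotheses, for every real ε > 0, if Q(m·ε) holds then Q(ε) holds. (One-step descent lemma for approximation of a closed subset, abstracting the descent step in the geometric formulation of Faltings' theorem on diophantine approximation on abelian varieties.) -/
/-- `SetApproxFinite h F δ` is the property `Q(δ)`: for every nonempty closed subset
`E` of `X` and every real `C > 0`, the set
`{x ∈ F : x ∉ E ∧ infDist x E ≤ C · exp (−δ · h x)}` is finite. -/
def SetApproxFinite {X : Type*} [MetricSpace X] (h : X → ℝ) (F : Set X) (δ : ℝ) : Prop :=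
  ∀ E : Set X, E.Nonempty → IsClosed E → ∀ C : ℝ, 0 < C →
    {x ∈ F | x ∉ E ∧ Metric.infDist x E ≤ C * Real.exp (-δ * h x)}.Finite

/-- One-step descent lemma for approximation of closed subsets: under the covering,
height-expansion, local covering law, Northcott and nonnegativity hypotheses,
for every `ε > 0`, `Q(m·ε)` implies `Q(ε)`. -/
theorem one_step_descent_sets {X : Type*} [MetricSpace X] [CompactSpace X]
    (h : X → ℝ) (F : Set X) (k : ℕ) (φ : Fin k → X → X)
    (hφcont : ∀ i, Continuous (φ i))
    (m C₁ c r : ℝ) (hm : 1 < m) (hC₁ : 0 ≤ C₁) (hc : 0 < c) (hr : 0 < r)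
    (hcover : ∀ x ∈ F, ∃ i, ∃ y ∈ F, φ i y = x)
    (hheight : ∀ i, ∀ y ∈ F, m * h y - C₁ ≤ h (φ i y))
    (hcovlaw : ∀ i, ∀ x e : X, dist (φ i x) e ≤ r →
      ∃ x' : X, φ i x' = e ∧ dist x x' ≤ (1 / c) * dist (φ i x) e)
    (hNorthcott : ∀ B : ℝ, {x ∈ F | h x ≤ B}.Finite)
    (hnonneg : ∀ x ∈ F, 0 ≤ h x)
    (ε : ℝ) (hε : 0 < ε)
    (hQ : SetApproxFinite h F (m * ε)) :
    SetApproxFinite h F ε := by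
  intro E hEne hEcl C hC
  let T : Fin k → Set X := fun i =>
    {y ∈ F | (φ i ⁻¹' E).Nonempty ∧ y ∉ φ i ⁻¹' E ∧ Metric.infDist y (φ i ⁻¹' E) ≤
      C / c * Real.exp (ε * C₁) * Real.exp (-(m * ε) * h y)}
  have hT : ∀ i, (T i).Finite := by
    intro i
    by_cases hne : (φ i ⁻¹' E).Nonempty
    · exact (hQ _ hne (hEcl.preimage (hφcont i)) (C / c * Real.exp (ε * C₁))
        (by positivity)).subset fun y hy => ⟨hy.1, hy.2.2⟩
    · exact Set.finite_empty.subset fun y hy => hne hy.2.1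
  refine ((hNorthcott (Real.log (C / r) / ε)).union
    (Set.finite_iUnion fun i => (hT i).image (φ i))).subset ?_
  rintro x ⟨hxF, hxE, hxd⟩
  rcases le_or_gt (h x) (Real.log (C / r) / ε) with hx | hx
  · exact Or.inl ⟨hxF, hx⟩
  right
  have hsmall : C * Real.exp (-ε * h x) ≤ r := by
    have hlog : Real.log (C / r) < ε * h x := by
      rw [div_lt_iff₀ hε] at hx
      linarith
    have hexp := (Real.log_lt_iff_lt_exp (by positivity)).1 hlog
    rw [div_lt_iff₀ hr] at hexp
    rw [neg_mul, Real.exp_neg, ← div_eq_mul_inv, div_le_iff₀ (Real.exp_pos _)]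
    linarith
  obtain ⟨i, y, hyF, rfl⟩ := hcover x hxF
  obtain ⟨e, heE, he⟩ := hEcl.isCompact.exists_infDist_eq_dist hEne (φ i y)
  rw [he] at hxd
  obtain ⟨x', hx'e, hx'd⟩ := hcovlaw i y e (hxd.trans hsmall)
  have hx'E : x' ∈ φ i ⁻¹' E := by
    rw [Set.mem_preimage, hx'e]
    exact heE
  refine Set.mem_iUnion.2 ⟨i, y, ⟨hyF, ⟨x', hx'E⟩, hxE, ?_⟩, rfl⟩
  calc Metric.infDist y (φ i ⁻¹' E) ≤ dist y x' := Metric.infDist_le_dist_of_mem hx'E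
    _ ≤ 1 / c * dist (φ i y) e := hx'd
    _ ≤ 1 / c * (C * Real.exp (-ε * h (φ i y))) := by gcongr
    _ ≤ 1 / c * (C * Real.exp (ε * C₁ + -(m * ε) * h y)) := by
        gcongr
        nlinarith [mul_le_mul_of_nonneg_left (hheight i y hyF) hε.le]
    _ = C / c * Real.exp (ε * C₁) * Real.exp (-(m * ε) * h y) := by
        rw [Real.exp_add]
        ring
end
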